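/- arXiv:1709.00876 — 7 statements merged into one kernel-verified Lean document; each statement's English description precedes it below -/
import Mathlib

section
/- Let a and b be two distinct complex numbers and let U = ℂ \ {a, b} be the twice-punctured complex plane, equipped with the subspace topology from ℂ. Then for any basepoint u ∈ U, the fundamental group π₁(U, u) is isomorphic (as a group) to the free group on two generators. -/
open CategoryTheory Topology

section PathsInSets

variable {X : Type*} [TopologicalSpace X]

/-- The homotopy classes of paths in `X` that have a representative inside `s`. -/
def IsPathClassIn (s : Set X) {x y : X}
    (q : FundamentalGroupoid.mk x ⟶ FundamentalGroupoid.mk y) : Prop :=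
  ∃ p : Path x y, (∀ t, p t ∈ s) ∧ Path.Homotopic.Quotient.mk p = q

namespace IsPathClassIn

variable {s t : Set X} {x y z : X}
  {q : FundamentalGroupoid.mk x ⟶ FundamentalGroupoid.mk y}
  {r : FundamentalGroupoid.mk y ⟶ FundamentalGroupoid.mk z}

theorem mono (hst : s ⊆ t) (hq : IsPathClassIn s q) : IsPathClassIn t q :=
  let ⟨p, hp, h⟩ := hq
  ⟨p, fun τ => hst (hp τ), h⟩

theorem comp (hq : IsPathClassIn s q) (hr : IsPathClassIn s r) : IsPathClassIn s (q ≫ r) := by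
  obtain ⟨p, hp, rfl⟩ := hq
  obtain ⟨p', hp', rfl⟩ := hr
  refine ⟨p.trans p', fun τ => ?_, rfl⟩
  have : p.trans p' τ ∈ Set.range (p.trans p') := ⟨τ, rfl⟩
  rw [Path.trans_range] at this
  rcases this with ⟨σ, h⟩ | ⟨σ, h⟩
  · exact h ▸ hp σ
  · exact h ▸ hp' σ

theorem inv (hq : IsPathClassIn s q) : IsPathClassIn s (Groupoid.inv q) := by
  obtain ⟨p, hp, rfl⟩ := hq
  exact ⟨p.symm, fun τ => hp _, rfl⟩

theorem eq_of_isSimplyConnected (hs : IsSimplyConnected s)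
    {q q' : FundamentalGroupoid.mk x ⟶ FundamentalGroupoid.mk y}
    (hq : IsPathClassIn s q) (hq' : IsPathClassIn s q') : q = q' := by
  obtain ⟨p, hp, rfl⟩ := hq
  obtain ⟨p', hp', rfl⟩ := hq'
  have := hs.simplyConnectedSpace
  have hx : x ∈ s := by simpa using hp 0
  have hy : y ∈ s := by simpa using hp 1
  let P : Path (⟨x, hx⟩ : s) ⟨y, hy⟩ := ⟨⟨fun τ => ⟨p τ, hp τ⟩, by fun_prop⟩, by simp, by simp⟩
  let P' : Path (⟨x, hx⟩ : s) ⟨y, hy⟩ := ⟨⟨fun τ => ⟨p' τ, hp' τ⟩, by fun_prop⟩, by simp, by simp⟩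
  exact Path.Homotopic.Quotient.eq.2
    ((SimplyConnectedSpace.paths_homotopic P P').map ⟨Subtype.val, continuous_subtype_val⟩)

end IsPathClassIn

theorem IsPathConnected.exists_isPathClassIn {s : Set X} (hs : IsPathConnected s) {x y : X}
    (hx : x ∈ s) (hy : y ∈ s) :
    ∃ q : FundamentalGroupoid.mk x ⟶ FundamentalGroupoid.mk y, IsPathClassIn s q :=
  let ⟨p, hp⟩ := hs.joinedIn x hx y hy
  ⟨_, p, hp, rfl⟩

/-- The monodromy along a path inside the base set of a trivialization preserves the
second coordinate. -/
theorem IsCoveringMap.snd_trivialization_monodromy {E F : Type*} [TopologicalSpace E]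
    [TopologicalSpace F] [DiscreteTopology F] {p : E → X} (cov : IsCoveringMap p)
    (T : Bundle.Trivialization F p) {x y : X}
    {q : FundamentalGroupoid.mk x ⟶ FundamentalGroupoid.mk y}
    (hq : IsPathClassIn T.baseSet q) (e : p ⁻¹' {x}) :
    (T (cov.monodromy q e).1).2 = (T e.1).2 := by
  obtain ⟨γ, hγ, rfl⟩ := hq
  have h0 : γ 0 = p e := γ.source.trans e.2.symm
  let L := cov.liftPath γ e h0
  have hL : ∀ t, L t ∈ T.source := fun t => by
    rw [T.mem_source]
    have : p (L t) = γ t := congr_fun (cov.liftPath_lifts γ e h0) t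
    exact this ▸ hγ t
  have hc : Continuous fun t => (T (L t)).2 :=
    continuous_snd.comp (T.continuousOn_toFun.comp_continuous L.continuous hL)
  have h01 := PreconnectedSpace.constant inferInstance hc (x := 1) (y := 0)
  have hL0 : L 0 = e := cov.liftPath_zero γ e h0
  rw [hL0] at h01
  exact h01

end PathsInSets

/-- An open cover of `X` by simply connected sets `U 0, …, U n`, any two of which meet exactly in
the union of two fixed disjoint path-connected open sets `A` and `B`. -/
structure FanCover (X : Type*) [TopologicalSpace X] (n : ℕ) where
  U : Fin (n + 1) → Set X
  A : Set X
  B : Set X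
  isOpen_U : ∀ i, IsOpen (U i)
  isOpen_A : IsOpen A
  isOpen_B : IsOpen B
  isSimplyConnected_U : ∀ i, IsSimplyConnected (U i)
  isPathConnected_A : IsPathConnected A
  isPathConnected_B : IsPathConnected B
  disjoint : Disjoint A B
  exists_mem_U : ∀ x, ∃ i, x ∈ U i
  A_subset_U : ∀ i, A ⊆ U i
  B_subset_U : ∀ i, B ⊆ U i
  inter_subset : ∀ i j, i ≠ j → U i ∩ U j ⊆ A ∪ B

namespace FanCover

variable {X : Type*} [TopologicalSpace X] {n : ℕ} (C : FanCover X n)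

section Covering

variable {G : Type*} [Group G] [TopologicalSpace G] [DiscreteTopology G] (g : Fin (n + 1) → G)

open Classical in
/-- The principal bundle over `X` that is trivial on each `U i`, with transition functions `1` on
`A` and `g j * (g i)⁻¹` on `B`. -/
noncomputable def bundleCore : FiberBundleCore (Fin (n + 1)) X G where
  baseSet := C.U
  isOpen_baseSet := C.isOpen_U
  indexAt x := (C.exists_mem_U x).choose
  mem_baseSet_at x := (C.exists_mem_U x).choose_spec
  coordChange i j x h := if x ∈ C.A then h else g j * (g i)⁻¹ * h
  coordChange_self i x _ h := by simp
  coordChange_comp i j k x _ h := by split_ifs <;> simp [mul_assoc]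
  continuousOn_coordChange i j := by
    rcases eq_or_ne i j with rfl | hij
    · simpa using continuousOn_snd
    rintro ⟨x, h⟩ ⟨hx, -⟩
    refine ContinuousAt.continuousWithinAt ?_
    rcases C.inter_subset i j hij hx with hA | hB
    · have : ContinuousAt (fun p : X × G => p.2) (x, h) := continuousAt_snd
      refine this.congr ?_
      filter_upwards [continuousAt_fst.preimage_mem_nhds (C.isOpen_A.mem_nhds hA)] with p hp
      exact (if_pos hp).symm
    · have : ContinuousAt (fun p : X × G => g j * (g i)⁻¹ * p.2) (x, h) :=
        continuous_of_discreteTopology.continuousAt.comp continuousAt_snd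
      refine this.congr ?_
      filter_upwards [continuousAt_fst.preimage_mem_nhds (C.isOpen_B.mem_nhds hB)] with p hp
      exact (if_neg fun hA => C.disjoint.notMem_of_mem_left hA hp).symm

theorem isCoveringMap_bundleCore_proj : IsCoveringMap (C.bundleCore g).proj :=
  FiberBundle.isCoveringMap (F := G) (E := (C.bundleCore g).Fiber)

theorem localTriv_snd_eq_of_mem_A (i j : Fin (n + 1)) (e : (C.bundleCore g).TotalSpace)
    (he : (C.bundleCore g).proj e ∈ C.A) :
    ((C.bundleCore g).localTriv i e).2 = ((C.bundleCore g).localTriv j e).2 := by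
  have he' : e.1 ∈ C.A := he
  rw [FiberBundleCore.localTriv_apply, FiberBundleCore.localTriv_apply]
  simp only [bundleCore, he']
  rfl

theorem localTriv_snd_eq_of_mem_B (i j : Fin (n + 1)) (e : (C.bundleCore g).TotalSpace)
    (he : (C.bundleCore g).proj e ∈ C.B) :
    ((C.bundleCore g).localTriv j e).2 =
      g j * (g i)⁻¹ * ((C.bundleCore g).localTriv i e).2 := by
  have he' : e.1 ∉ C.A := fun hA => C.disjoint.notMem_of_mem_left hA he
  rw [FiberBundleCore.localTriv_apply, FiberBundleCore.localTriv_apply]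
  simp [bundleCore, he', mul_assoc]

end Covering

/-- A base point in `A`. -/
noncomputable def a : X := C.isPathConnected_A.nonempty.some

theorem a_mem : C.a ∈ C.A := C.isPathConnected_A.nonempty.some_mem

/-- A base point in `B`. -/
noncomputable def b : X := C.isPathConnected_B.nonempty.some

theorem b_mem : C.b ∈ C.B := C.isPathConnected_B.nonempty.some_mem

theorem exists_pathClass (i : Fin (n + 1)) {x : X} (hx : x ∈ C.U i) :
    ∃ q : FundamentalGroupoid.mk C.a ⟶ FundamentalGroupoid.mk x, IsPathClassIn (C.U i) q :=
  (C.isSimplyConnected_U i).isPathConnected.exists_isPathClassIn (C.A_subset_U i C.a_mem) hx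

/-- The unique class of paths from the base point to `x` inside `U i`. -/
noncomputable def pathClass (i : Fin (n + 1)) {x : X} (hx : x ∈ C.U i) :
    FundamentalGroupoid.mk C.a ⟶ FundamentalGroupoid.mk x :=
  (C.exists_pathClass i hx).choose

theorem isPathClassIn_pathClass (i : Fin (n + 1)) {x : X} (hx : x ∈ C.U i) :
    IsPathClassIn (C.U i) (C.pathClass i hx) :=
  (C.exists_pathClass i hx).choose_spec

theorem pathClass_eq {i : Fin (n + 1)} {x : X} (hx : x ∈ C.U i)
    {q : FundamentalGroupoid.mk C.a ⟶ FundamentalGroupoid.mk x} (hq : IsPathClassIn (C.U i) q) :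
    C.pathClass i hx = q :=
  (C.isPathClassIn_pathClass i hx).eq_of_isSimplyConnected (C.isSimplyConnected_U i) hq

theorem pathClass_comp {i : Fin (n + 1)} {x y : X} (hx : x ∈ C.U i) (hy : y ∈ C.U i)
    {q : FundamentalGroupoid.mk x ⟶ FundamentalGroupoid.mk y} (hq : IsPathClassIn (C.U i) q) :
    C.pathClass i hx ≫ q = C.pathClass i hy :=
  (C.pathClass_eq hy ((C.isPathClassIn_pathClass i hx).comp hq)).symm

theorem pathClass_eq_of_mem_A (i j : Fin (n + 1)) {x : X} (hx : x ∈ C.A) :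
    C.pathClass i (C.A_subset_U i hx) = C.pathClass j (C.A_subset_U j hx) := by
  obtain ⟨q, hq⟩ := C.isPathConnected_A.exists_isPathClassIn C.a_mem hx
  rw [C.pathClass_eq _ (hq.mono (C.A_subset_U i)), C.pathClass_eq _ (hq.mono (C.A_subset_U j))]

/-- The class of paths from `a` to `b` inside `U i`. -/
noncomputable def crossing (i : Fin (n + 1)) :
    FundamentalGroupoid.mk C.a ⟶ FundamentalGroupoid.mk C.b :=
  C.pathClass i (C.B_subset_U i C.b_mem)

/-- The loop that goes from `a` to `b` through `U i`, and back through `U j`. -/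
noncomputable def loop (i j : Fin (n + 1)) : FundamentalGroup X C.a :=
  C.crossing i ≫ Groupoid.inv (C.crossing j)

/-- The homomorphism sending the `k`-th free generator to the loop crossing from `A` to `B`
through `U 0` and returning through `U (k + 1)`. -/
noncomputable def freeGroupHom : FreeGroup (Fin n) →* FundamentalGroup X C.a :=
  FreeGroup.lift fun k => C.loop 0 k.succ

theorem loop_zero_mem_range (i : Fin (n + 1)) : C.loop 0 i ∈ C.freeGroupHom.range := by
  induction i using Fin.cases with
  | zero =>
    have : C.loop 0 0 = 1 := Groupoid.comp_inv _
    exact this ▸ one_mem _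
  | succ k => exact ⟨.of k, FreeGroup.lift_apply_of⟩

theorem loop_mem_range (i j : Fin (n + 1)) : C.loop i j ∈ C.freeGroupHom.range := by
  have : C.loop i j = C.loop 0 j * (C.loop 0 i)⁻¹ := by
    rw [eq_mul_inv_iff_mul_eq]
    change C.loop 0 i ≫ C.loop i j = C.loop 0 j
    simp [loop]
  exact this ▸ mul_mem (C.loop_zero_mem_range j) (inv_mem (C.loop_zero_mem_range i))

theorem exists_pathClass_eq (i j : Fin (n + 1)) {x : X} (hi : x ∈ C.U i) (hj : x ∈ C.U j) :
    ∃ w ∈ C.freeGroupHom.range, C.pathClass i hi = w ≫ C.pathClass j hj := by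
  rcases eq_or_ne i j with rfl | hij
  · exact ⟨1, one_mem _, (Category.id_comp _).symm⟩
  rcases C.inter_subset i j hij ⟨hi, hj⟩ with hA | hB
  · exact ⟨1, one_mem _, (C.pathClass_eq_of_mem_A i j hA).trans (Category.id_comp _).symm⟩
  · obtain ⟨q, hq⟩ := C.isPathConnected_B.exists_isPathClassIn C.b_mem hB
    refine ⟨C.loop i j, C.loop_mem_range i j, ?_⟩
    rw [← C.pathClass_comp (C.B_subset_U i C.b_mem) hi (hq.mono (C.B_subset_U i)),
      ← C.pathClass_comp (C.B_subset_U j C.b_mem) hj (hq.mono (C.B_subset_U j))]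
    simp [loop, crossing]

/-- The path classes from the base point which are a product of generating loops, followed by a
path inside some `U i`. -/
def IsGenerated {x : X} (q : FundamentalGroupoid.mk C.a ⟶ FundamentalGroupoid.mk x) : Prop :=
  ∃ (i : Fin (n + 1)) (hx : x ∈ C.U i), ∃ w ∈ C.freeGroupHom.range, q = w ≫ C.pathClass i hx

theorem IsGenerated.exists_eq {C : FanCover X n} {x : X}
    {q : FundamentalGroupoid.mk C.a ⟶ FundamentalGroupoid.mk x}
    (hq : C.IsGenerated q) (j : Fin (n + 1)) (hj : x ∈ C.U j) :
    ∃ w ∈ C.freeGroupHom.range, q = w ≫ C.pathClass j hj := by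
  obtain ⟨i, hi, w, hw, rfl⟩ := hq
  obtain ⟨v, hv, h⟩ := C.exists_pathClass_eq i j hi hj
  exact ⟨v * w, mul_mem hv hw, by rw [h]; exact (Category.assoc _ _ _).symm⟩

theorem IsGenerated.comp {C : FanCover X n} {x y : X}
    {q : FundamentalGroupoid.mk C.a ⟶ FundamentalGroupoid.mk x} (hq : C.IsGenerated q)
    {i : Fin (n + 1)} (hx : x ∈ C.U i) (hy : y ∈ C.U i)
    {r : FundamentalGroupoid.mk x ⟶ FundamentalGroupoid.mk y} (hr : IsPathClassIn (C.U i) r) :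
    C.IsGenerated (q ≫ r) := by
  obtain ⟨w, hw, rfl⟩ := hq.exists_eq i hx
  exact ⟨i, hy, w, hw, by rw [← C.pathClass_comp hx hy hr]; exact Category.assoc _ _ _⟩

theorem isGenerated_pathClass (i : Fin (n + 1)) {x : X} (hx : x ∈ C.U i) :
    C.IsGenerated (C.pathClass i hx) :=
  ⟨i, hx, 1, one_mem _, (Category.id_comp _).symm⟩

theorem isGenerated_id : C.IsGenerated (𝟙 (FundamentalGroupoid.mk C.a)) := by
  convert C.isGenerated_pathClass 0 (C.A_subset_U 0 C.a_mem)
  exact (C.pathClass_eq _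
    ⟨Path.refl _, fun _ => C.A_subset_U 0 C.a_mem, rfl⟩).symm

theorem IsGenerated.comp_mk {C : FanCover X n} {x y : X}
    {q : FundamentalGroupoid.mk C.a ⟶ FundamentalGroupoid.mk x} (hq : C.IsGenerated q)
    (γ : Path x y) : C.IsGenerated (x := y) (q ≫ Path.Homotopic.Quotient.mk γ) := by
  obtain ⟨f, rfl, rfl⟩ := γ
  let γ : Path (f 0) (f 1) := ⟨f, rfl, rfl⟩
  let S (s t : unitInterval) : FundamentalGroupoid.mk (f s) ⟶ FundamentalGroupoid.mk (f t) :=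
    Path.Homotopic.Quotient.mk (γ.subpath s t)
  have hS (r s t) : S r s ≫ S s t = S r t :=
    Path.Homotopic.Quotient.eq.2 ⟨Path.Homotopy.subpathTransSubpath γ r s t⟩
  have hconst : IsLocallyConstant fun t => C.IsGenerated (q ≫ S 0 t) := by
    rw [IsLocallyConstant.iff_eventually_eq]
    intro t
    obtain ⟨i, hi⟩ := C.exists_mem_U (f t)
    obtain ⟨ε, hε, hball⟩ := Metric.mem_nhds_iff.1
      (f.continuous.continuousAt.preimage_mem_nhds ((C.isOpen_U i).mem_nhds hi))
    filter_upwards [Metric.ball_mem_nhds t hε] with s hs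
    have hts : IsPathClassIn (C.U i) (S t s) := by
      refine ⟨_, fun τ => ?_, rfl⟩
      obtain ⟨r, hr, h⟩ : γ.subpath t s τ ∈ γ '' Set.uIcc t s :=
        γ.range_subpath t s ▸ ⟨τ, rfl⟩
      rw [← h]
      refine hball (Metric.mem_ball.2 (lt_of_le_of_lt ?_ (Metric.mem_ball.1 hs)))
      have hr' : (r : ℝ) ∈ Set.uIcc (t : ℝ) s := by
        rw [Set.mem_uIcc] at hr ⊢
        exact hr
      exact Set.abs_sub_left_of_mem_uIcc hr'
    have hst : Groupoid.inv (S t s) = S s t :=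
      congrArg Path.Homotopic.Quotient.mk (γ.symm_subpath t s)
    refine propext ⟨fun h => ?_, fun h => ?_⟩
    · have := h.comp (hball hs) hi (hst ▸ hts.inv)
      rwa [Category.assoc, hS] at this
    · have := h.comp hi (hball hs) hts
      rwa [Category.assoc, hS] at this
  have h0 : S 0 0 = 𝟙 _ := congrArg Path.Homotopic.Quotient.mk (γ.subpath_self 0)
  have h1 : S 0 1 = Path.Homotopic.Quotient.mk γ :=
    congrArg Path.Homotopic.Quotient.mk γ.subpath_zero_one
  change C.IsGenerated (x := f 1) (q ≫ Path.Homotopic.Quotient.mk γ)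
  rw [← h1]
  refine (hconst.apply_eq_of_preconnectedSpace 0 1).mp ?_
  rw [h0]
  exact (Category.comp_id q).symm ▸ hq

theorem freeGroupHom_surjective : Function.Surjective C.freeGroupHom := by
  intro q
  obtain ⟨γ, rfl⟩ := Path.Homotopic.Quotient.mk_surjective q
  obtain ⟨w, hw, h⟩ := (C.isGenerated_id.comp_mk γ).exists_eq 0 (C.A_subset_U 0 C.a_mem)
  have hid : C.pathClass 0 (C.A_subset_U 0 C.a_mem) = 𝟙 _ :=
    C.pathClass_eq _ ⟨Path.refl _, fun _ => C.A_subset_U 0 C.a_mem, rfl⟩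
  rw [Category.id_comp, hid] at h
  have h' : Path.Homotopic.Quotient.mk γ = w := h.trans (Category.comp_id w)
  exact h' ▸ hw

section Monodromy

variable {G : Type*} [Group G] [TopologicalSpace G] [DiscreteTopology G] (g : Fin (n + 1) → G)

theorem localTriv_snd_monodromy_loop (k i j : Fin (n + 1))
    (e : (C.bundleCore g).proj ⁻¹' {C.a}) :
    ((C.bundleCore g).localTriv k
        ((C.isCoveringMap_bundleCore_proj g).monodromy (C.loop i j) e).1).2 =
      g j * (g i)⁻¹ * ((C.bundleCore g).localTriv k e.1).2 := by
  set cov := C.isCoveringMap_bundleCore_proj g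
  have hA (e : (C.bundleCore g).proj ⁻¹' {C.a}) : (C.bundleCore g).proj e.1 ∈ C.A :=
    have : (C.bundleCore g).proj e.1 = C.a := e.2
    this.symm ▸ C.a_mem
  have hB (e : (C.bundleCore g).proj ⁻¹' {C.b}) : (C.bundleCore g).proj e.1 ∈ C.B :=
    have : (C.bundleCore g).proj e.1 = C.b := e.2
    this.symm ▸ C.b_mem
  have hloop : cov.monodromy (C.loop i j) e =
      cov.monodromy (Groupoid.inv (C.crossing j)) (cov.monodromy (C.crossing i) e) :=
    cov.monodromy_trans_apply _ _ _
  have hc (i) : IsPathClassIn ((C.bundleCore g).localTriv i).baseSet (C.crossing i) :=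
    C.isPathClassIn_pathClass i (C.B_subset_U i C.b_mem)
  rw [hloop, C.localTriv_snd_eq_of_mem_A g k j _ (hA _),
    cov.snd_trivialization_monodromy ((C.bundleCore g).localTriv j) (hc j).inv,
    C.localTriv_snd_eq_of_mem_B g i j _ (hB _),
    cov.snd_trivialization_monodromy ((C.bundleCore g).localTriv i) (hc i),
    C.localTriv_snd_eq_of_mem_A g i k _ (hA _)]

end Monodromy

theorem freeGroupHom_injective : Function.Injective C.freeGroupHom := by
  let _ : TopologicalSpace (FreeGroup (Fin n)) := ⊥
  have : DiscreteTopology (FreeGroup (Fin n)) := ⟨rfl⟩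
  let g : Fin (n + 1) → FreeGroup (Fin n) := Fin.cons 1 FreeGroup.of
  let Z := C.bundleCore g
  let cov := C.isCoveringMap_bundleCore_proj g
  have key (w : FreeGroup (Fin n)) : ∀ e : Z.proj ⁻¹' {C.a},
      (Z.localTriv 0 (cov.monodromyPerm C.a (C.freeGroupHom w) e).1).2 =
        w * (Z.localTriv 0 e.1).2 := by
    induction w using FreeGroup.induction_on with
    | C1 =>
      intro e
      rw [map_one, map_one, Equiv.Perm.one_apply, one_mul]
    | of k =>
      intro e
      have := C.localTriv_snd_monodromy_loop g 0 0 k.succ e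
      simpa [freeGroupHom, g] using this
    | inv_of k ih =>
      intro e
      rw [eq_inv_mul_iff_mul_eq, ← ih]
      simp
    | mul v w hv hw => intro e; rw [map_mul, map_mul, Equiv.Perm.mul_apply, hv, hw, mul_assoc]
  rw [injective_iff_map_eq_one]
  intro w hw
  let e : Z.proj ⁻¹' {C.a} := ⟨⟨C.a, (1 : FreeGroup (Fin n))⟩, rfl⟩
  have h := key w e
  rw [hw, map_one, Equiv.Perm.one_apply] at h
  exact right_eq_mul.1 h

/-- The fundamental group of a space with a fan cover by `n + 1` sets is free on `n` generators. -/
noncomputable def freeGroupEquiv : FreeGroup (Fin n) ≃* FundamentalGroup X C.a :=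
  MulEquiv.ofBijective C.freeGroupHom ⟨C.freeGroupHom_injective, C.freeGroupHom_surjective⟩

theorem nonempty_fundamentalGroup_mulEquiv (C : FanCover X n) (x : X) :
    Nonempty (FundamentalGroup X x ≃* FreeGroup (Fin n)) := by
  obtain ⟨i, hi⟩ := C.exists_mem_U x
  obtain ⟨p, -⟩ := C.exists_pathClass i hi
  obtain ⟨γ, -⟩ := Path.Homotopic.Quotient.mk_surjective p
  exact ⟨(C.freeGroupEquiv.trans (FundamentalGroup.fundamentalGroupMulEquivOfPath γ)).symm⟩

end FanCover

section TwicePuncturedPlane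

open Complex

variable {a b : ℂ}

/-- The affine coordinate of the plane in which `a` is `0` and `b` is `1`. -/
noncomputable def affineCoord (a b z : ℂ) : ℂ := (z - a) / (b - a)

theorem continuous_affineCoord (a b : ℂ) : Continuous (affineCoord a b) := by
  unfold affineCoord; fun_prop

theorem affineCoord_combo (a b z w : ℂ) {s t : ℝ} (hst : s + t = 1) :
    affineCoord a b (s • z + t • w) = s • affineCoord a b z + t • affineCoord a b w := by
  obtain rfl : s = 1 - t := by linarith
  simp only [affineCoord, real_smul, ofReal_sub, ofReal_one]
  ring

theorem affineCoord_lineMap (hab : a ≠ b) (c : ℂ) : affineCoord a b (a + c * (b - a)) = c := by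
  have : b - a ≠ 0 := sub_ne_zero.2 hab.symm
  simp [affineCoord, this]

theorem affineCoord_left (a b : ℂ) : affineCoord a b a = 0 := by simp [affineCoord]

theorem affineCoord_right (hab : a ≠ b) : affineCoord a b b = 1 :=
  div_self (sub_ne_zero.2 hab.symm)

theorem eq_left_of_affineCoord_eq_zero (hab : a ≠ b) {z : ℂ} (h : affineCoord a b z = 0) :
    z = a := by
  simpa [affineCoord, sub_eq_zero, hab.symm] using h

theorem eq_right_of_affineCoord_eq_one (hab : a ≠ b) {z : ℂ} (h : affineCoord a b z = 1) :
    z = b := by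
  have : b - a ≠ 0 := sub_ne_zero.2 hab.symm
  simpa [affineCoord, div_eq_one_iff_eq this] using h

/-- The points of the plane whose affine coordinate is not real, or is in the real set `J`. -/
def slitPlaneOver (a b : ℂ) (J : Set ℝ) : Set ℂ :=
  {z | (affineCoord a b z).im ≠ 0 ∨ (affineCoord a b z).re ∈ J}

theorem isOpen_slitPlaneOver (a b : ℂ) {J : Set ℝ} (hJ : IsOpen J) :
    IsOpen (slitPlaneOver a b J) :=
  (isOpen_ne.preimage (continuous_im.comp (continuous_affineCoord a b))).union
    (hJ.preimage (continuous_re.comp (continuous_affineCoord a b)))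

theorem isSimplyConnected_slitPlaneOver (hab : a ≠ b) {J : Set ℝ} (hJ : Convex ℝ J)
    (hne : J.Nonempty) : IsSimplyConnected (slitPlaneOver a b J) := by
  obtain ⟨c, hc⟩ := hne
  have hp := affineCoord_lineMap hab c
  have hmem : a + c * (b - a) ∈ slitPlaneOver a b J := by
    right; rwa [hp, ofReal_re]
  have hstar : StarConvex ℝ (a + c * (b - a)) (slitPlaneOver a b J) := by
    intro z hz s t hs ht hst
    change _ ∨ _
    rw [affineCoord_combo _ _ _ _ hst, hp]
    simp only [add_im, add_re, smul_im, smul_re, ofReal_im, ofReal_re, smul_zero, zero_add]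
    by_cases h : t • (affineCoord a b z).im = 0
    · right
      rcases smul_eq_zero.1 h with rfl | h
      · obtain rfl : s = 1 := by linarith
        simpa using hc
      · exact hJ hc (hz.resolve_left (not_not.2 h)) hs ht hst
    · exact .inl h
  have := hstar.contractibleSpace ⟨_, hmem⟩
  exact SimplyConnectedSpace.ofContractible _

theorem isPathConnected_affineCoord_preimage (hab : a ≠ b) {S : Set ℂ} (hS : Convex ℝ S)
    (hne : S.Nonempty) : IsPathConnected (affineCoord a b ⁻¹' S) := by
  refine Convex.isPathConnected (fun z hz w hw s t hs ht hst => ?_) ?_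
  · rw [Set.mem_preimage, affineCoord_combo _ _ _ _ hst]
    exact hS hz hw hs ht hst
  · obtain ⟨c, hc⟩ := hne
    exact ⟨a + c * (b - a), by rwa [Set.mem_preimage, affineCoord_lineMap hab]⟩

/-- The three components of the real line minus the points `0` and `1`. -/
def realGap : Fin 3 → Set ℝ := ![Set.Iio 0, Set.Ioo 0 1, Set.Ioi 1]

theorem isOpen_realGap (i : Fin 3) : IsOpen (realGap i) := by
  fin_cases i
  exacts [isOpen_Iio, isOpen_Ioo, isOpen_Ioi]

theorem convex_realGap (i : Fin 3) : Convex ℝ (realGap i) := by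
  fin_cases i
  exacts [convex_Iio 0, convex_Ioo 0 1, convex_Ioi 1]

theorem realGap_nonempty (i : Fin 3) : (realGap i).Nonempty := by
  fin_cases i
  exacts [Set.nonempty_Iio, Set.nonempty_Ioo.2 one_pos, Set.nonempty_Ioi]

theorem exists_mem_realGap_iff {r : ℝ} : (∃ i, r ∈ realGap i) ↔ r ≠ 0 ∧ r ≠ 1 := by
  simp [Fin.exists_fin_succ, realGap]
  grind

theorem disjoint_realGap {i j : Fin 3} (hij : i ≠ j) : Disjoint (realGap i) (realGap j) := by
  rw [Set.disjoint_left]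
  intro r hi hj
  fin_cases i <;> fin_cases j <;> simp [realGap] at hij hi hj <;> linarith

theorem mem_slitPlaneOver_realGap_ne (hab : a ≠ b) {i : Fin 3} {z : ℂ}
    (hz : z ∈ slitPlaneOver a b (realGap i)) : z ≠ a ∧ z ≠ b := by
  have h (w : ℂ) (hw : affineCoord a b w = 0 ∨ affineCoord a b w = 1) :
      w ∉ slitPlaneOver a b (realGap i) := by
    rintro (him | hre)
    · rcases hw with hw | hw <;> simp [hw] at him
    · have := exists_mem_realGap_iff.1 ⟨i, hre⟩
      rcases hw with hw | hw <;> simp [hw] at this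
  constructor <;> rintro rfl
  · exact h _ (.inl (affineCoord_left _ _)) hz
  · exact h _ (.inr (affineCoord_right hab)) hz

theorem exists_mem_slitPlaneOver_realGap (hab : a ≠ b) {z : ℂ} (hz : z ≠ a ∧ z ≠ b) :
    ∃ i, z ∈ slitPlaneOver a b (realGap i) := by
  by_cases him : (affineCoord a b z).im = 0
  · obtain ⟨i, hi⟩ := exists_mem_realGap_iff.2
      (⟨fun h => hz.1 (eq_left_of_affineCoord_eq_zero hab (Complex.ext h him)),
        fun h => hz.2 (eq_right_of_affineCoord_eq_one hab (Complex.ext h him))⟩ :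
        (affineCoord a b z).re ≠ 0 ∧ (affineCoord a b z).re ≠ 1)
    exact ⟨i, .inr hi⟩
  · exact ⟨0, .inl him⟩

/-- The cover of the twice-punctured plane by three slit planes, which meet in the two half-planes
bounded by the line through the punctures. -/
def twicePuncturedPlaneFanCover (hab : a ≠ b) : FanCover {z : ℂ // z ≠ a ∧ z ≠ b} 2 where
  U i := Subtype.val ⁻¹' slitPlaneOver a b (realGap i)
  A := Subtype.val ⁻¹' (affineCoord a b ⁻¹' {w | 0 < w.im})
  B := Subtype.val ⁻¹' (affineCoord a b ⁻¹' {w | w.im < 0})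
  isOpen_U i := (isOpen_slitPlaneOver a b (isOpen_realGap i)).preimage continuous_subtype_val
  isOpen_A := ((isOpen_lt continuous_const continuous_im).preimage
    (continuous_affineCoord a b)).preimage continuous_subtype_val
  isOpen_B := ((isOpen_lt continuous_im continuous_const).preimage
    (continuous_affineCoord a b)).preimage continuous_subtype_val
  isSimplyConnected_U i := by
    rw [← IsEmbedding.subtypeVal.isSimplyConnected_image, Set.image_preimage_eq_of_subset
      fun z hz => ⟨⟨z, mem_slitPlaneOver_realGap_ne hab hz⟩, rfl⟩]
    exact isSimplyConnected_slitPlaneOver hab (convex_realGap i) (realGap_nonempty i)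
  isPathConnected_A := by
    rw [IsEmbedding.subtypeVal.isInducing.isPathConnected_iff, Set.image_preimage_eq_of_subset
      fun z hz => ⟨⟨z, mem_slitPlaneOver_realGap_ne (i := 0) hab (.inl (ne_of_gt hz))⟩, rfl⟩]
    exact isPathConnected_affineCoord_preimage hab (convex_halfSpace_im_gt 0) ⟨I, by simp⟩
  isPathConnected_B := by
    rw [IsEmbedding.subtypeVal.isInducing.isPathConnected_iff, Set.image_preimage_eq_of_subset
      fun z hz => ⟨⟨z, mem_slitPlaneOver_realGap_ne (i := 0) hab (.inl (ne_of_lt hz))⟩, rfl⟩]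
    exact isPathConnected_affineCoord_preimage hab (convex_halfSpace_im_lt 0) ⟨-I, by simp⟩
  disjoint := Set.disjoint_left.2 fun _ hA hB => lt_asymm (a := (0 : ℝ)) hA hB
  exists_mem_U z := exists_mem_slitPlaneOver_realGap hab z.2
  A_subset_U _ _ hz := .inl (ne_of_gt hz)
  B_subset_U _ _ hz := .inl (ne_of_lt hz)
  inter_subset i j hij z hz := by
    by_cases him : (affineCoord a b z).im = 0
    · exact ((disjoint_realGap hij).notMem_of_mem_left (hz.1.resolve_left (not_not.2 him))
        (hz.2.resolve_left (not_not.2 him))).elim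
    · exact (lt_or_gt_of_ne him).symm

end TwicePuncturedPlane

/-- The fundamental group of the twice-punctured complex plane `ℂ \ {a, b}`
(with `a ≠ b`), at any basepoint, is isomorphic to the free group on two
generators. -/
theorem fundamentalGroup_twice_punctured_plane_free
    (a b : ℂ) (hab : a ≠ b) (u : {z : ℂ // z ≠ a ∧ z ≠ b}) :
    Nonempty (FundamentalGroup {z : ℂ // z ≠ a ∧ z ≠ b} u ≃* FreeGroup (Fin 2)) :=
  (twicePuncturedPlaneFanCover hab).nonempty_fundamentalGroup_mulEquiv u
end

section
/- Let A, B ∈ SL₂(ℂ) and set x = tr(A), y = tr(B), z = tr(AB). Then A and B have a common eigenvector (i.e., there exists a nonzero vector v ∈ ℂ² with Av ∈ ℂ·v and Bv ∈ ℂ·v) if and only if z² − xyz + x² + y² − 4 = 0. -/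
open Matrix

/-- The determinant of the commutator of two `2 × 2` matrices in terms of traces and
determinants. -/
theorem det_commutator_fin_two {R : Type*} [CommRing R] (A B : Matrix (Fin 2) (Fin 2) R) :
    (A * B - B * A).det = -((A * B).trace ^ 2 - A.trace * B.trace * (A * B).trace
      + A.trace ^ 2 * B.det + B.trace ^ 2 * A.det - 4 * A.det * B.det) := by
  simp only [det_fin_two, trace_fin_two, Matrix.sub_apply, mul_apply, Fin.sum_univ_two]
  ring

/-- Polarized Cayley-Hamilton for `A` and the commutator of `A` with `B`. -/
theorem commutator_mul_fin_two {R : Type*} [CommRing R] (A B : Matrix (Fin 2) (Fin 2) R) :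
    (A * B - B * A) * A = A.trace • (A * B - B * A) - A * (A * B - B * A) := by
  ext i j
  fin_cases i <;> fin_cases j <;>
    simp [trace_fin_two, mul_apply, Fin.sum_univ_two] <;> ring

/-- A nonzero `2 × 2` matrix over a field has kernel of dimension at most one. -/
theorem exists_eq_smul_of_mulVec_eq_zero {K : Type*} [Field K] {N : Matrix (Fin 2) (Fin 2) K}
    (hN : N ≠ 0) {v w : Fin 2 → K} (hv : v ≠ 0) (hNv : N *ᵥ v = 0) (hNw : N *ᵥ w = 0) :
    ∃ c : K, w = c • v := by
  have hdet : v 0 * w 1 - v 1 * w 0 = 0 := by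
    by_contra h
    refine hN (Matrix.ext fun i j => ?_)
    have h1 : N i 0 * v 0 + N i 1 * v 1 = 0 := by
      simpa [mulVec, dotProduct, Fin.sum_univ_two] using congrFun hNv i
    have h2 : N i 0 * w 0 + N i 1 * w 1 = 0 := by
      simpa [mulVec, dotProduct, Fin.sum_univ_two] using congrFun hNw i
    refine (mul_eq_zero.mp ?_).resolve_right h
    fin_cases j <;> simp only [Fin.zero_eta, Fin.mk_one]
    · linear_combination w 1 * h1 - v 1 * h2
    · linear_combination v 0 * h2 - w 0 * h1
  by_cases h0 : v 0 = 0
  · have h1 : v 1 ≠ 0 := fun h1 => hv (by ext i; fin_cases i <;> simp [h0, h1])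
    refine ⟨w 1 / v 1, ?_⟩
    ext i
    fin_cases i
    · simpa [h0, h1] using hdet
    · simp [h1]
  · refine ⟨w 0 / v 0, ?_⟩
    ext i
    fin_cases i
    · simp [h0]
    · simp only [Fin.mk_one, Pi.smul_apply, smul_eq_mul]
      field_simp
      linear_combination hdet

theorem exists_mulVec_eq_smul {K : Type*} [Field K] [IsAlgClosed K]
    (A : Matrix (Fin 2) (Fin 2) K) : ∃ v : Fin 2 → K, v ≠ 0 ∧ ∃ c : K, A *ᵥ v = c • v := by
  obtain ⟨c, hc⟩ := Module.End.exists_eigenvalue (Matrix.toLin' A)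
  obtain ⟨v, hv⟩ := hc.exists_hasEigenvector
  exact ⟨v, hv.2, c, by simpa using hv.apply_eq_smul⟩

theorem exists_common_eigenvector_of_commute {K : Type*} [Field K] [IsAlgClosed K]
    {A B : Matrix (Fin 2) (Fin 2) K} (h : A * B = B * A) :
    ∃ v : Fin 2 → K, v ≠ 0 ∧ (∃ c : K, A *ᵥ v = c • v) ∧ ∃ c : K, B *ᵥ v = c • v := by
  obtain ⟨v, hv, c, hc⟩ := exists_mulVec_eq_smul A
  by_cases hN : A - c • (1 : Matrix (Fin 2) (Fin 2) K) = 0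
  · obtain ⟨w, hw, d, hd⟩ := exists_mulVec_eq_smul B
    exact ⟨w, hw, ⟨c, by rw [sub_eq_zero.mp hN, smul_mulVec, one_mulVec]⟩, d, hd⟩
  · refine ⟨v, hv, ⟨c, hc⟩, exists_eq_smul_of_mulVec_eq_zero hN hv ?_ ?_⟩
    · rw [sub_mulVec, smul_mulVec, one_mulVec, hc, sub_self]
    · rw [sub_mulVec, smul_mulVec, one_mulVec, mulVec_mulVec, h, ← mulVec_mulVec, hc,
        mulVec_smul, sub_self]

/-- Two `2 × 2` matrices over an algebraically closed field have a common eigenvector if and only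
if their commutator is singular. -/
theorem exists_common_eigenvector_iff_det_commutator_eq_zero {K : Type*} [Field K] [IsAlgClosed K]
    (A B : Matrix (Fin 2) (Fin 2) K) :
    (∃ v : Fin 2 → K, v ≠ 0 ∧ (∃ c : K, A *ᵥ v = c • v) ∧ ∃ c : K, B *ᵥ v = c • v) ↔
      (A * B - B * A).det = 0 := by
  constructor
  · rintro ⟨v, hv, ⟨a, ha⟩, b, hb⟩
    refine exists_mulVec_eq_zero_iff.mp ⟨v, hv, ?_⟩
    rw [sub_mulVec, ← mulVec_mulVec, ← mulVec_mulVec, ha, hb, mulVec_smul, mulVec_smul, ha, hb,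
      smul_comm, sub_self]
  · intro h
    by_cases hC : A * B - B * A = 0
    · exact exists_common_eigenvector_of_commute (sub_eq_zero.mp hC)
    · obtain ⟨v, hv, hCv⟩ := exists_mulVec_eq_zero_iff.mpr h
      refine ⟨v, hv, exists_eq_smul_of_mulVec_eq_zero hC hv hCv ?_,
        exists_eq_smul_of_mulVec_eq_zero hC hv hCv ?_⟩
      · rw [mulVec_mulVec, commutator_mul_fin_two, sub_mulVec, smul_mulVec, ← mulVec_mulVec, hCv,
          mulVec_zero, smul_zero, sub_self]
      · have hBA : (B * A - A * B) *ᵥ v = 0 := by rw [← neg_sub, neg_mulVec, hCv, neg_zero]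
        have hBA' : (B * A - A * B) *ᵥ (B *ᵥ v) = 0 := by
          rw [mulVec_mulVec, commutator_mul_fin_two, sub_mulVec, smul_mulVec, ← mulVec_mulVec, hBA,
            mulVec_zero, smul_zero, sub_self]
        rw [← neg_sub, neg_mulVec, hBA', neg_zero]

/-- A pair `A, B ∈ SL₂(ℂ)` has a common eigenvector if and only if the trace
coordinates `x = tr A`, `y = tr B`, `z = tr (AB)` satisfy
`z² - xyz + x² + y² - 4 = 0`. -/
theorem common_eigenvector_iff_trace_relation
    (A B : Matrix.SpecialLinearGroup (Fin 2) ℂ) (x y z : ℂ)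
    (hx : x = Matrix.trace (A : Matrix (Fin 2) (Fin 2) ℂ))
    (hy : y = Matrix.trace (B : Matrix (Fin 2) (Fin 2) ℂ))
    (hz : z = Matrix.trace ((A * B : Matrix.SpecialLinearGroup (Fin 2) ℂ) :
      Matrix (Fin 2) (Fin 2) ℂ)) :
    (∃ v : Fin 2 → ℂ, v ≠ 0 ∧
        (∃ c : ℂ, (A : Matrix (Fin 2) (Fin 2) ℂ).mulVec v = c • v) ∧
        (∃ c : ℂ, (B : Matrix (Fin 2) (Fin 2) ℂ).mulVec v = c • v)) ↔
      z ^ 2 - x * y * z + x ^ 2 + y ^ 2 - 4 = 0 := by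
  have hz' : z = ((A : Matrix (Fin 2) (Fin 2) ℂ) * (B : Matrix (Fin 2) (Fin 2) ℂ)).trace := hz
  rw [exists_common_eigenvector_iff_det_commutator_eq_zero, det_commutator_fin_two, neg_eq_zero,
    A.det_coe, B.det_coe, hx, hy, hz']
  simp only [mul_one]
end

section
/- Let A, B ∈ SL₂(ℂ). Then A and B have a common eigenvector (i.e., there exists a nonzero vector v ∈ ℂ² with Av ∈ ℂ·v and Bv ∈ ℂ·v) if and only if tr(A B A⁻¹ B⁻¹) = 2. -/
open Matrix

/-- For `2 × 2` matrices of determinant one, the trace of the group commutator measures the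
degeneracy of the additive commutator. -/
theorem trace_commutator_eq_two_sub_det {R : Type*} [CommRing R]
    (A B : Matrix.SpecialLinearGroup (Fin 2) R) :
    Matrix.trace ((A * B * A⁻¹ * B⁻¹ : Matrix.SpecialLinearGroup (Fin 2) R) :
        Matrix (Fin 2) (Fin 2) R) =
      2 - ((A : Matrix (Fin 2) (Fin 2) R) * (B : Matrix (Fin 2) (Fin 2) R) -
        (B : Matrix (Fin 2) (Fin 2) R) * (A : Matrix (Fin 2) (Fin 2) R)).det := by
  have hA := A.det_coe
  have hB := B.det_coe
  rw [det_fin_two] at hA hB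
  change trace ((A : Matrix (Fin 2) (Fin 2) R) * (B : Matrix (Fin 2) (Fin 2) R) *
    adjugate (A : Matrix (Fin 2) (Fin 2) R) * adjugate (B : Matrix (Fin 2) (Fin 2) R)) = _
  simp only [adjugate_fin_two,
    trace_fin_two, det_fin_two, mul_apply, Fin.sum_univ_two, Matrix.sub_apply, of_apply, cons_val_zero,
    cons_val_one, cons_val', cons_val_fin_one]
  linear_combination (2 * (B 0 0 * B 1 1 - B 0 1 * B 1 0)) * hA + 2 * hB

/-- The determinant of the pair `(v, M v)` for `v = (s, t)`: the binary quadratic form whose zeros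
are the eigenvectors of `M`. -/
def eigenform {K : Type*} [Field K] (M : Matrix (Fin 2) (Fin 2) K) (s t : K) : K :=
  M 1 0 * s ^ 2 - (M 0 0 - M 1 1) * s * t - M 0 1 * t ^ 2

theorem exists_mulVec_eq_smul_of_eigenform_eq_zero {K : Type*} [Field K]
    {M : Matrix (Fin 2) (Fin 2) K} {s t : K} (hv : s ≠ 0 ∨ t ≠ 0) (h : eigenform M s t = 0) :
    ∃ c : K, M.mulVec ![s, t] = c • ![s, t] := by
  unfold eigenform at h
  rcases hv with hs | ht
  · refine ⟨(M 0 0 * s + M 0 1 * t) / s, ?_⟩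
    ext i
    fin_cases i
    · simp [mulVec, dotProduct, Fin.sum_univ_two, hs]
    · simp [mulVec, dotProduct, Fin.sum_univ_two]
      field_simp
      linear_combination h
  · refine ⟨(M 1 0 * s + M 1 1 * t) / t, ?_⟩
    ext i
    fin_cases i
    · simp [mulVec, dotProduct, Fin.sum_univ_two]
      field_simp
      linear_combination -h
    · simp [mulVec, dotProduct, Fin.sum_univ_two, ht]

theorem exists_eigenform_eq_zero {K : Type*} [Field K] [IsAlgClosed K]
    (M : Matrix (Fin 2) (Fin 2) K) : ∃ s t : K, (s ≠ 0 ∨ t ≠ 0) ∧ eigenform M s t = 0 := by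
  obtain ⟨c, hc⟩ := Module.End.exists_eigenvalue (Matrix.toLin' M)
  obtain ⟨v, hv⟩ := hc.exists_hasEigenvector
  have h := hv.apply_eq_smul
  rw [toLin'_apply] at h
  have h0 := congrFun h 0
  have h1 := congrFun h 1
  simp only [mulVec, dotProduct, Fin.sum_univ_two, Pi.smul_apply, smul_eq_mul] at h0 h1
  refine ⟨v 0, v 1, ?_, ?_⟩
  · by_contra! hz
    exact hv.2 (by ext i; fin_cases i <;> simp [hz])
  · unfold eigenform
    linear_combination v 0 * h1 - v 1 * h0

/-- If the additive commutator of two `2 × 2` matrices over an algebraically closed field is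
singular, then their eigenforms have a common zero. -/
theorem exists_common_eigenform_eq_zero {K : Type*} [Field K] [IsAlgClosed K]
    {A B : Matrix (Fin 2) (Fin 2) K} (h : (A * B - B * A).det = 0) :
    ∃ s t : K, (s ≠ 0 ∨ t ≠ 0) ∧ eigenform A s t = 0 ∧ eigenform B s t = 0 := by
  obtain ⟨p, hp⟩ : ∃ p, p = A 0 1 * B 1 0 - B 0 1 * A 1 0 := ⟨_, rfl⟩
  obtain ⟨q, hq⟩ : ∃ q, q = B 0 1 * (A 0 0 - A 1 1) - A 0 1 * (B 0 0 - B 1 1) := ⟨_, rfl⟩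
  obtain ⟨r, hr⟩ : ∃ r, r = A 1 0 * (B 0 0 - B 1 1) - B 1 0 * (A 0 0 - A 1 1) := ⟨_, rfl⟩
  have hpqr : p ^ 2 + q * r = 0 := by
    simp only [det_fin_two, mul_apply, Fin.sum_univ_two, Matrix.sub_apply] at h
    subst hp hq hr
    linear_combination -h
  have hA : A 1 0 * q + (A 0 0 - A 1 1) * p + A 0 1 * r = 0 := by subst hp hq hr; ring
  have hB : B 1 0 * q + (B 0 0 - B 1 1) * p + B 0 1 * r = 0 := by subst hp hq hr; ring
  by_cases hpr : p ≠ 0 ∨ r ≠ 0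
  · refine ⟨p, r, hpr, ?_, ?_⟩ <;> unfold eigenform
    · linear_combination A 1 0 * hpqr - r * hA
    · linear_combination B 1 0 * hpqr - r * hB
  obtain ⟨rfl, rfl⟩ : p = 0 ∧ r = 0 := by simpa using hpr
  by_cases hq0 : q = 0
  swap
  · refine ⟨q, 0, Or.inl hq0, ?_, ?_⟩ <;> unfold eigenform
    · linear_combination q * hA
    · linear_combination q * hB
  subst hq0
  by_cases hscalar : A 1 0 = 0 ∧ A 0 0 - A 1 1 = 0 ∧ A 0 1 = 0
  · obtain ⟨s, t, hst, hBst⟩ := exists_eigenform_eq_zero B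
    exact ⟨s, t, hst, by simp [eigenform, hscalar], hBst⟩
  obtain ⟨s, t, hst, hAst⟩ := exists_eigenform_eq_zero A
  refine ⟨s, t, hst, hAst, ?_⟩
  have hlower : A 1 0 * eigenform B s t = 0 := by
    unfold eigenform at *
    linear_combination B 1 0 * hAst + s * t * hr - t ^ 2 * hp
  have hdiag : (A 0 0 - A 1 1) * eigenform B s t = 0 := by
    unfold eigenform at *
    linear_combination (B 0 0 - B 1 1) * hAst + s ^ 2 * hr + t ^ 2 * hq
  have hupper : A 0 1 * eigenform B s t = 0 := by
    unfold eigenform at *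
    linear_combination B 0 1 * hAst - s ^ 2 * hp - s * t * hq
  by_contra hBst
  exact hscalar ⟨(mul_eq_zero.mp hlower).resolve_right hBst,
    (mul_eq_zero.mp hdiag).resolve_right hBst, (mul_eq_zero.mp hupper).resolve_right hBst⟩

/-- A pair `A, B ∈ SL₂(ℂ)` has a common eigenvector if and only if
`tr(ABA⁻¹B⁻¹) = 2`. -/
theorem common_eigenvector_iff_trace_commutator_eq_two
    (A B : Matrix.SpecialLinearGroup (Fin 2) ℂ) :
    (∃ v : Fin 2 → ℂ, v ≠ 0 ∧
        (∃ c : ℂ, (A : Matrix (Fin 2) (Fin 2) ℂ).mulVec v = c • v) ∧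
        (∃ c : ℂ, (B : Matrix (Fin 2) (Fin 2) ℂ).mulVec v = c • v)) ↔
      Matrix.trace ((A * B * A⁻¹ * B⁻¹ : Matrix.SpecialLinearGroup (Fin 2) ℂ) :
        Matrix (Fin 2) (Fin 2) ℂ) = 2 := by
  rw [trace_commutator_eq_two_sub_det, sub_eq_self]
  constructor
  · rintro ⟨v, hv, ⟨a, ha⟩, ⟨b, hb⟩⟩
    refine exists_mulVec_eq_zero_iff.mp ⟨v, hv, ?_⟩
    rw [sub_mulVec, ← mulVec_mulVec, ← mulVec_mulVec, ha, hb, mulVec_smul, mulVec_smul, ha, hb,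
      smul_comm, sub_self]
  · intro h
    obtain ⟨s, t, hst, hA, hB⟩ := exists_common_eigenform_eq_zero h
    refine ⟨![s, t], fun h0 => ?_, exists_mulVec_eq_smul_of_eigenform_eq_zero hst hA,
      exists_mulVec_eq_smul_of_eigenform_eq_zero hst hB⟩
    have hs : s = 0 := congrFun h0 0
    have ht : t = 0 := congrFun h0 1
    simp [hs, ht] at hst
end

section
/- The trace-coordinate map from pairs of SL₂(ℂ) matrices to ℂ³ is surjective: for every (x, y, z) ∈ ℂ³ there exist matrices A, B ∈ SL₂(ℂ) with tr(A) = x, tr(B) = y, and tr(AB) = z. -/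
open Matrix

/-- The trace-coordinate map `(A, B) ↦ (tr A, tr B, tr (AB))` on pairs of
matrices in `SL₂(ℂ)` is surjective onto `ℂ³`. -/
theorem trace_coordinates_surjective (x y z : ℂ) :
    ∃ A B : Matrix.SpecialLinearGroup (Fin 2) ℂ,
      Matrix.trace (A : Matrix (Fin 2) (Fin 2) ℂ) = x ∧
      Matrix.trace (B : Matrix (Fin 2) (Fin 2) ℂ) = y ∧
      Matrix.trace ((A * B : Matrix.SpecialLinearGroup (Fin 2) ℂ) :
        Matrix (Fin 2) (Fin 2) ℂ) = z := by
  obtain ⟨s, hs⟩ := IsAlgClosed.exists_eq_mul_self (z ^ 2 - 4)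
  obtain ⟨A, hA⟩ : ∃ A : SpecialLinearGroup (Fin 2) ℂ,
      (A : Matrix (Fin 2) (Fin 2) ℂ) = !![x, -1; 1, 0] := ⟨⟨_, by simp⟩, rfl⟩
  obtain ⟨B, hB⟩ : ∃ B : SpecialLinearGroup (Fin 2) ℂ,
      (B : Matrix (Fin 2) (Fin 2) ℂ) = !![0, (z + s) / 2; -((z - s) / 2), y] := by
    refine ⟨⟨_, ?_⟩, rfl⟩
    rw [det_fin_two_of]
    linear_combination hs / 4
  refine ⟨A, B, by simp [hA, trace_fin_two], by simp [hB, trace_fin_two], ?_⟩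
  change trace ((A : Matrix (Fin 2) (Fin 2) ℂ) * (B : Matrix (Fin 2) (Fin 2) ℂ)) = z
  rw [hA, hB, mul_fin_two, trace_fin_two_of]
  ring
end

section
/- Let A, B, A′, B′ ∈ SL₂(ℂ) be such that the pair (A, B) has no common eigenvector and the pair (A′, B′) has no common eigenvector. If tr(A) = tr(A′), tr(B) = tr(B′), and tr(AB) = tr(A′B′), then the two pairs are conjugate: there exists P ∈ GL₂(ℂ) with A′ = P A P⁻¹ and B′ = P B P⁻¹. -/
open Matrix

/-- If `v` is an eigenvector of `A` but not of `B`, then in the basis `(v, B v)` the pair `(A, B)`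
takes a normal form depending only on the eigenvalue, the traces and `det B`. -/
theorem exists_conj_normalForm_of_eigenvector {K : Type*} [Field K]
    (A B : Matrix (Fin 2) (Fin 2) K) {l : K} {v : Fin 2 → K} (hv : v ≠ 0)
    (hA : A *ᵥ v = l • v) (hB : ¬ ∃ c : K, B *ᵥ v = c • v) :
    ∃ Q : GL (Fin 2) K,
      A * Q.val = Q.val * !![l, (A * B).trace - (A.trace - l) * B.trace; 0, A.trace - l] ∧
      B * Q.val = Q.val * !![0, -B.det; 1, B.trace] := by
  have hdet : (!![v 0, (B *ᵥ v) 0; v 1, (B *ᵥ v) 1]).det ≠ 0 := by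
    rw [det_fin_two_of]
    intro h
    apply hB
    by_cases h0 : v 0 = 0
    · have h1 : v 1 ≠ 0 := fun h1 => hv (by ext i; fin_cases i <;> assumption)
      refine ⟨(B *ᵥ v) 1 / v 1, funext (Fin.forall_fin_two.mpr ⟨?_, ?_⟩)⟩
      · rw [Pi.smul_apply, smul_eq_mul, div_mul_eq_mul_div, eq_div_iff h1]
        linear_combination -h
      · rw [Pi.smul_apply, smul_eq_mul, div_mul_cancel₀ _ h1]
    · refine ⟨(B *ᵥ v) 0 / v 0, funext (Fin.forall_fin_two.mpr ⟨?_, ?_⟩)⟩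
      · rw [Pi.smul_apply, smul_eq_mul, div_mul_cancel₀ _ h0]
      · rw [Pi.smul_apply, smul_eq_mul, div_mul_eq_mul_div, eq_div_iff h0]
        linear_combination h
  have h0 := congrFun hA 0
  have h1 := congrFun hA 1
  simp only [mulVec, dotProduct, Fin.sum_univ_two, Pi.smul_apply, smul_eq_mul] at h0 h1
  refine ⟨GeneralLinearGroup.mkOfDetNeZero _ hdet, ?_, ?_⟩
  · ext i j
    fin_cases i <;> fin_cases j <;>
      simp [GeneralLinearGroup.mkOfDetNeZero, mul_apply, mulVec, dotProduct, trace_fin_two]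
    · linear_combination h0
    · linear_combination B 1 1 * h0 - B 0 1 * h1
    · linear_combination h1
    · linear_combination B 0 0 * h1 - B 1 0 * h0
  · ext i j
    fin_cases i <;> fin_cases j <;>
      simp [GeneralLinearGroup.mkOfDetNeZero, mul_apply, mulVec, dotProduct, trace_fin_two,
        det_fin_two] <;> ring

/-- A root of the characteristic polynomial of a `2 × 2` matrix has an eigenvector. -/
theorem exists_mulVec_eq_smul_of_charpoly_root {K : Type*} [Field K]
    (A : Matrix (Fin 2) (Fin 2) K) {l : K} (hl : l ^ 2 - A.trace * l + A.det = 0) :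
    ∃ v : Fin 2 → K, v ≠ 0 ∧ A *ᵥ v = l • v := by
  have h : (A - l • (1 : Matrix (Fin 2) (Fin 2) K)).det = 0 := by
    rw [trace_fin_two, det_fin_two] at hl
    simp [det_fin_two]
    linear_combination hl
  obtain ⟨v, hv, h⟩ := exists_mulVec_eq_zero_iff.mpr h
  exact ⟨v, hv, by rwa [sub_mulVec, smul_mulVec, one_mulVec, sub_eq_zero] at h⟩

/-- Matrices intertwined with a common matrix are conjugate. -/
theorem eq_conj_of_mul_eq_mul {n K : Type*} [Fintype n] [DecidableEq n] [CommRing K]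
    {M M' C : Matrix n n K} {Q Q' : GL n K}
    (h : M * Q.val = Q.val * C) (h' : M' * Q'.val = Q'.val * C) :
    M' = (Q' * Q⁻¹).val * M * ((Q' * Q⁻¹)⁻¹).val := by
  have hC : C = Q⁻¹.val * M * Q.val := by
    rw [Matrix.mul_assoc, h, Units.inv_mul_cancel_left]
  rw [hC] at h'
  rw [_root_.mul_inv_rev, inv_inv, Units.val_mul, Units.val_mul]
  simp only [← Matrix.mul_assoc] at h' ⊢
  rw [← h', Units.mul_inv_cancel_right]

/-- Two irreducible pairs in `SL₂(ℂ)` (i.e. pairs having no common eigenvector)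
with the same trace coordinates `(tr A, tr B, tr (AB))` are conjugate by an
element of `GL₂(ℂ)`. -/
theorem irreducible_pairs_with_same_traces_are_conjugate
    (A B A' B' : Matrix.SpecialLinearGroup (Fin 2) ℂ)
    (hAB : ¬ ∃ v : Fin 2 → ℂ, v ≠ 0 ∧
        (∃ c : ℂ, (A : Matrix (Fin 2) (Fin 2) ℂ).mulVec v = c • v) ∧
        (∃ c : ℂ, (B : Matrix (Fin 2) (Fin 2) ℂ).mulVec v = c • v))
    (hAB' : ¬ ∃ v : Fin 2 → ℂ, v ≠ 0 ∧
        (∃ c : ℂ, (A' : Matrix (Fin 2) (Fin 2) ℂ).mulVec v = c • v) ∧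
        (∃ c : ℂ, (B' : Matrix (Fin 2) (Fin 2) ℂ).mulVec v = c • v))
    (hx : Matrix.trace (A : Matrix (Fin 2) (Fin 2) ℂ)
        = Matrix.trace (A' : Matrix (Fin 2) (Fin 2) ℂ))
    (hy : Matrix.trace (B : Matrix (Fin 2) (Fin 2) ℂ)
        = Matrix.trace (B' : Matrix (Fin 2) (Fin 2) ℂ))
    (hz : Matrix.trace ((A * B : Matrix.SpecialLinearGroup (Fin 2) ℂ) :
            Matrix (Fin 2) (Fin 2) ℂ)
        = Matrix.trace ((A' * B' : Matrix.SpecialLinearGroup (Fin 2) ℂ) :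
            Matrix (Fin 2) (Fin 2) ℂ)) :
    ∃ P : GL (Fin 2) ℂ,
      (A' : Matrix (Fin 2) (Fin 2) ℂ)
          = (P : Matrix (Fin 2) (Fin 2) ℂ) * (A : Matrix (Fin 2) (Fin 2) ℂ) *
            ((P⁻¹ : GL (Fin 2) ℂ) : Matrix (Fin 2) (Fin 2) ℂ) ∧
      (B' : Matrix (Fin 2) (Fin 2) ℂ)
          = (P : Matrix (Fin 2) (Fin 2) ℂ) * (B : Matrix (Fin 2) (Fin 2) ℂ) *
            ((P⁻¹ : GL (Fin 2) ℂ) : Matrix (Fin 2) (Fin 2) ℂ) := by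
  obtain ⟨s, hs⟩ := IsAlgClosed.exists_pow_nat_eq (A.val.trace ^ 2 - 4) two_pos
  obtain ⟨l, hl⟩ : ∃ l : ℂ, l ^ 2 - A.val.trace * l + 1 = 0 :=
    ⟨(A.val.trace + s) / 2, by linear_combination hs / 4⟩
  obtain ⟨v, hv, hAv⟩ := exists_mulVec_eq_smul_of_charpoly_root A.val (l := l)
    (by rw [A.det_coe, hl])
  obtain ⟨v', hv', hAv'⟩ := exists_mulVec_eq_smul_of_charpoly_root A'.val (l := l)
    (by rw [A'.det_coe, ← hx, hl])
  obtain ⟨Q, hQA, hQB⟩ := exists_conj_normalForm_of_eigenvector A.val B.val hv hAv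
    fun h => hAB ⟨v, hv, ⟨l, hAv⟩, h⟩
  obtain ⟨Q', hQA', hQB'⟩ := exists_conj_normalForm_of_eigenvector A'.val B'.val hv' hAv'
    fun h => hAB' ⟨v', hv', ⟨l, hAv'⟩, h⟩
  replace hz : (A.val * B.val).trace = (A'.val * B'.val).trace := hz
  rw [← hx, ← hy, ← hz] at hQA'
  rw [← hy, B'.det_coe] at hQB'
  rw [B.det_coe] at hQB
  exact ⟨Q' * Q⁻¹, eq_conj_of_mul_eq_mul hQA hQA', eq_conj_of_mul_eq_mul hQB hQB'⟩
end

section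
/- Let A, B ∈ SL₂(ℂ) and suppose the pair (A, B) acts semisimply on ℂ², in the sense that every linear subspace W ⊆ ℂ² with AW ⊆ W and BW ⊆ W admits a complementary subspace W′ (ℂ² = W ⊕ W′) with AW′ ⊆ W′ and BW′ ⊆ W′. If tr(A) = tr(B) = tr(AB) = 2, then A = I and B = I. (Equivalently, the only semisimple rank 2 local system with trace coordinates (2,2,2) is the trivial one.) -/
open Matrix

/-- Two trace-zero, determinant-zero `2 × 2` matrices over a field whose product has trace zero
multiply to zero. -/
theorem mul_eq_zero_of_trace_eq_zero_of_det_eq_zero {K : Type*} [Field K]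
    {M N : Matrix (Fin 2) (Fin 2) K} (hM : M.trace = 0) (hM' : M.det = 0)
    (hN : N.trace = 0) (hN' : N.det = 0) (hMN : (M * N).trace = 0) : M * N = 0 := by
  simp only [Matrix.trace_fin_two, Matrix.det_fin_two, Matrix.mul_apply, Fin.sum_univ_two]
    at hM hM' hN hN' hMN
  have hM₁ : M 1 1 = -M 0 0 := by linear_combination hM
  have hN₁ : N 1 1 = -N 0 0 := by linear_combination hN
  rw [hM₁] at hM' hMN
  rw [hN₁] at hN' hMN
  ext i j
  fin_cases i <;> fin_cases j <;>
    simp only [Fin.zero_eta, Fin.mk_one, Matrix.mul_apply, Fin.sum_univ_two, Matrix.zero_apply,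
      hM₁, hN₁] <;>
    refine pow_eq_zero_iff two_ne_zero |>.mp ?_ <;> grind

/-- If every subspace invariant under `A` and `B` has a complement invariant under `A`, and
`A - 1` has square zero and annihilates `B - 1` on the left, then `A = 1`. -/
theorem eq_one_of_invariant_complements {K n : Type*} [Field K] [Fintype n] [DecidableEq n]
    {A B : Matrix n n K}
    (hss : ∀ W : Submodule K (n → K), (∀ v ∈ W, A *ᵥ v ∈ W) → (∀ v ∈ W, B *ᵥ v ∈ W) →
      ∃ W' : Submodule K (n → K), IsCompl W W' ∧ ∀ v ∈ W', A *ᵥ v ∈ W')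
    (hA : (A - 1) * (A - 1) = 0) (hAB : (A - 1) * (B - 1) = 0) : A = 1 := by
  have hker {C : Matrix n n K} (hC : (A - 1) * (C - 1) = 0) :
      ∀ v ∈ LinearMap.ker (A - 1).mulVecLin, C *ᵥ v ∈ LinearMap.ker (A - 1).mulVecLin := by
    intro v hv
    rw [LinearMap.mem_ker, Matrix.mulVecLin_apply] at hv ⊢
    have h : (A - 1) * C = A - 1 := by rwa [mul_sub, mul_one, sub_eq_zero] at hC
    rw [Matrix.mulVec_mulVec, h, hv]
  obtain ⟨W', hW, hAW⟩ := hss _ (hker hA) (hker hAB)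
  have hbot : W' ≤ LinearMap.ker (A - 1).mulVecLin := by
    intro w hw
    have hmem : (A - 1) *ᵥ w ∈ W' := by
      rw [Matrix.sub_mulVec, Matrix.one_mulVec]
      exact W'.sub_mem (hAW w hw) hw
    refine Submodule.disjoint_def.mp hW.disjoint _ ?_ hmem
    simp only [LinearMap.mem_ker, Matrix.mulVecLin_apply, Matrix.mulVec_mulVec, hA,
      Matrix.zero_mulVec]
  have htop : LinearMap.ker (A - 1).mulVecLin = ⊤ := by
    rw [← hW.sup_eq_top, sup_eq_left.mpr hbot]
  rw [← sub_eq_zero]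
  exact Matrix.ext_of_mulVec_single fun i =>
    (LinearMap.congr_fun (LinearMap.ker_eq_top.mp htop) (Pi.single i 1)).trans
      (Matrix.zero_mulVec _).symm

/-- If a pair `A, B ∈ SL₂(ℂ)` acts semisimply on `ℂ²` (every subspace invariant
under both `A` and `B` has an invariant complement) and
`tr A = tr B = tr (AB) = 2`, then `A = I` and `B = I`. -/
theorem semisimple_pair_trace_two_two_two_is_trivial
    (A B : Matrix.SpecialLinearGroup (Fin 2) ℂ)
    (hss : ∀ W : Submodule ℂ (Fin 2 → ℂ),
      (∀ v ∈ W, (A : Matrix (Fin 2) (Fin 2) ℂ).mulVec v ∈ W) →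
      (∀ v ∈ W, (B : Matrix (Fin 2) (Fin 2) ℂ).mulVec v ∈ W) →
      ∃ W' : Submodule ℂ (Fin 2 → ℂ), IsCompl W W' ∧
        (∀ v ∈ W', (A : Matrix (Fin 2) (Fin 2) ℂ).mulVec v ∈ W') ∧
        (∀ v ∈ W', (B : Matrix (Fin 2) (Fin 2) ℂ).mulVec v ∈ W'))
    (hA : Matrix.trace (A : Matrix (Fin 2) (Fin 2) ℂ) = 2)
    (hB : Matrix.trace (B : Matrix (Fin 2) (Fin 2) ℂ) = 2)
    (hAB : Matrix.trace ((A * B : Matrix.SpecialLinearGroup (Fin 2) ℂ) :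
      Matrix (Fin 2) (Fin 2) ℂ) = 2) :
    A = 1 ∧ B = 1 := by
  have hdet {C : Matrix.SpecialLinearGroup (Fin 2) ℂ}
      (hC : Matrix.trace (C : Matrix (Fin 2) (Fin 2) ℂ) = 2) :
      ((C : Matrix (Fin 2) (Fin 2) ℂ) - 1).det = 0 := by
    have h := C.det_coe
    rw [Matrix.det_fin_two] at h
    rw [Matrix.trace_fin_two] at hC
    simp only [Matrix.det_fin_two, Matrix.sub_apply, Matrix.one_apply_eq, ne_eq, zero_ne_one,
      one_ne_zero, not_false_eq_true, Matrix.one_apply_ne]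
    linear_combination h - hC
  have htr {C : Matrix (Fin 2) (Fin 2) ℂ} (hC : C.trace = 2) : (C - 1).trace = 0 := by
    simp [Matrix.trace_sub, hC]
  have hmul {C D : Matrix (Fin 2) (Fin 2) ℂ} (hC : C.trace = 2) (hD : D.trace = 2)
      (hCD : (C * D).trace = 2) : ((C - 1) * (D - 1)).trace = 0 := by
    simp [sub_mul, mul_sub, Matrix.trace_sub, hC, hD, hCD]
  have hsq {C : Matrix (Fin 2) (Fin 2) ℂ} (hC : C.trace = 0) (hC' : C.det = 0) :
      (C * C).trace = 0 := by
    rw [Matrix.trace_fin_two] at hC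
    rw [Matrix.det_fin_two] at hC'
    simp only [Matrix.trace_fin_two, Matrix.mul_apply, Fin.sum_univ_two]
    linear_combination (C 0 0 + C 1 1) * hC - 2 * hC'
  rw [Matrix.SpecialLinearGroup.coe_mul] at hAB
  have hBA := hAB
  rw [Matrix.trace_mul_comm] at hBA
  have hzero := @mul_eq_zero_of_trace_eq_zero_of_det_eq_zero ℂ _
  constructor
  · refine Subtype.ext (eq_one_of_invariant_complements (B := B.1) (fun W h₁ h₂ => ?_) ?_ ?_)
    · obtain ⟨W', h, hW, -⟩ := hss W h₁ h₂
      exact ⟨W', h, hW⟩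
    · exact hzero (htr hA) (hdet hA) (htr hA) (hdet hA) (hsq (htr hA) (hdet hA))
    · exact hzero (htr hA) (hdet hA) (htr hB) (hdet hB) (hmul hA hB hAB)
  · refine Subtype.ext (eq_one_of_invariant_complements (B := A.1) (fun W h₁ h₂ => ?_) ?_ ?_)
    · obtain ⟨W', h, -, hW⟩ := hss W h₂ h₁
      exact ⟨W', h, hW⟩
    · exact hzero (htr hB) (hdet hB) (htr hB) (hdet hB) (hsq (htr hB) (hdet hB))
    · exact hzero (htr hB) (hdet hB) (htr hA) (hdet hA) (hmul hB hA hBA)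
end

section
/- Let A, B ∈ SL₂(ℂ). If tr(A) = 2 and tr(AB) = tr(B), then A and B have a common eigenvector, i.e., there exists a nonzero vector v ∈ ℂ² with Av ∈ ℂ·v and Bv ∈ ℂ·v. (Equivalently, the locus {x = 2, y = z} in trace coordinates is contained in the reducibility locus z² − xyz + x² + y² − 4 = 0.) -/
open Matrix

/-- Every square complex matrix of positive size has an eigenvector. -/
lemma exists_mulVec_eq_smul_s11 {n : Type*} [Fintype n] [DecidableEq n] [Nonempty n]
    (M : Matrix n n ℂ) : ∃ v : n → ℂ, v ≠ 0 ∧ ∃ c : ℂ, M.mulVec v = c • v := by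
  obtain ⟨c, hc⟩ := Module.End.exists_eigenvalue (Matrix.toLin' M)
  obtain ⟨v, hv⟩ := hc.exists_hasEigenvector
  exact ⟨v, hv.2, c, by simpa using hv.apply_eq_smul⟩

/-- If `A, B ∈ SL₂(ℂ)` satisfy `tr A = 2` and `tr (AB) = tr B`, then `A` and
`B` have a common eigenvector. -/
theorem common_eigenvector_of_trace_conditions
    (A B : Matrix.SpecialLinearGroup (Fin 2) ℂ)
    (hA : Matrix.trace (A : Matrix (Fin 2) (Fin 2) ℂ) = 2)
    (hAB : Matrix.trace ((A * B : Matrix.SpecialLinearGroup (Fin 2) ℂ) :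
        Matrix (Fin 2) (Fin 2) ℂ)
      = Matrix.trace (B : Matrix (Fin 2) (Fin 2) ℂ)) :
    ∃ v : Fin 2 → ℂ, v ≠ 0 ∧
      (∃ c : ℂ, (A : Matrix (Fin 2) (Fin 2) ℂ).mulVec v = c • v) ∧
      (∃ c : ℂ, (B : Matrix (Fin 2) (Fin 2) ℂ).mulVec v = c • v) := by
  have hdet : (A 0 0 - 1) ^ 2 + A 0 1 * A 1 0 = 0 := by
    have h := A.det_coe
    rw [Matrix.det_fin_two] at h
    rw [Matrix.trace_fin_two] at hA
    linear_combination A 0 0 * hA - h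
  have h11 : A 1 1 = 2 - A 0 0 := by
    rw [Matrix.trace_fin_two] at hA
    linear_combination hA
  have htr : (A 0 0 - 1) * B 0 0 + A 0 1 * B 1 0 + A 1 0 * B 0 1
      - (A 0 0 - 1) * B 1 1 = 0 := by
    simp only [Matrix.SpecialLinearGroup.coe_mul, Matrix.trace_fin_two, Matrix.mul_apply,
      Fin.sum_univ_two] at hAB
    linear_combination hAB - B 1 1 * h11
  by_cases hq : A 0 1 = 0
  · have hp : A 0 0 = 1 := by
      have : (A 0 0 - 1) ^ 2 = 0 := by simpa [hq] using hdet
      exact sub_eq_zero.mp (pow_eq_zero_iff two_ne_zero |>.mp this)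
    by_cases hr : A 1 0 = 0
    · obtain ⟨v, hv, hB⟩ := exists_mulVec_eq_smul_s11 (B : Matrix (Fin 2) (Fin 2) ℂ)
      refine ⟨v, hv, ⟨1, ?_⟩, hB⟩
      ext i
      fin_cases i <;> simp [Matrix.mulVec, dotProduct, Fin.sum_univ_two, hq, hr, hp, h11]
      norm_num
    · have hf : B 0 1 = 0 := by simpa [hq, hp, hr] using htr
      refine ⟨![0, 1], by simp, ⟨A 1 1, ?_⟩, ⟨B 1 1, ?_⟩⟩ <;>
        ext i <;> fin_cases i <;> simp [Matrix.mulVec, dotProduct, Fin.sum_univ_two, hq, hf]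
  · refine ⟨![A 0 1, 1 - A 0 0], by simp [hq], ⟨1, ?_⟩,
      ⟨(B 0 0 * A 0 1 + B 0 1 * (1 - A 0 0)) / A 0 1, ?_⟩⟩
    · ext i
      fin_cases i <;> simp [Matrix.mulVec, dotProduct, Fin.sum_univ_two]
      · ring
      · linear_combination hdet + (1 - A 0 0) * h11
    · ext i
      fin_cases i <;> simp [Matrix.mulVec, dotProduct, Fin.sum_univ_two] <;> field_simp
      linear_combination A 0 1 * htr - B 0 1 * hdet
end
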